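/- There exist two non-isomorphic compact semisimple Lie groups G¹ and G² (both quotients of SU(2)^n by central subgroups) such that the multisets of dimensions of their irreducible complex representations coincide; equivalently, their Witten zeta-functions ζ_G(s) = ∑_{V irreducible} (dim V)^{−s} are equal. -/

import Mathlib

/-- The special unitary group `SU(2)`, as the subgroup of the unitary group
`U(2)` of matrices of determinant `1`. -/
def SU2 : Subgroup (Matrix.unitaryGroup (Fin 2) ℂ) where
  carrier := {A | (A : Matrix (Fin 2) (Fin 2) ℂ).det = 1}
  one_mem' := by simp [Set.mem_setOf_eq]
  mul_mem' := by
    intro a b ha hb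
    simp only [Set.mem_setOf_eq, Matrix.UnitaryGroup.mul_val, Matrix.det_mul] at *
    rw [ha, hb, mul_one]
  inv_mem' := by
    intro a ha
    simp only [Set.mem_setOf_eq, Matrix.UnitaryGroup.inv_val] at *
    rw [show (star a : Matrix (Fin 2) (Fin 2) ℂ) =
          Matrix.conjTranspose (a : Matrix (Fin 2) (Fin 2) ℂ) from rfl,
      Matrix.det_conjTranspose, ha, star_one]

/-- The underlying matrix of an element of `SU(2)`. -/
def SU2.toMatrix (x : SU2) : Matrix (Fin 2) (Fin 2) ℂ := ((x : Matrix.unitaryGroup (Fin 2) ℂ) : Matrix (Fin 2) (Fin 2) ℂ)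

/-- A continuous irreducible `d`-dimensional complex matrix representation of a
topological group `H`. -/
def IrredRep (H : Type) [Group H] [TopologicalSpace H] (d : ℕ) : Type :=
  {ρ : H →* (Matrix (Fin d) (Fin d) ℂ)ˣ //
    Continuous (fun g => ((ρ g : (Matrix (Fin d) (Fin d) ℂ)ˣ) : Matrix (Fin d) (Fin d) ℂ)) ∧
    ∀ W : Submodule ℂ (Fin d → ℂ),
      (∀ g : H, ∀ v ∈ W,
        Matrix.mulVec ((ρ g : (Matrix (Fin d) (Fin d) ℂ)ˣ) : Matrix (Fin d) (Fin d) ℂ) v ∈ W) →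
      W = ⊥ ∨ W = ⊤}

/-- Equivalence of representations: conjugacy by an invertible matrix. -/
def repIso {H : Type} [Group H] [TopologicalSpace H] {d : ℕ}
    (r s : IrredRep H d) : Prop :=
  ∃ P : (Matrix (Fin d) (Fin d) ℂ)ˣ, ∀ g, P * r.1 g = s.1 g * P

/-- The number (cardinality) of isomorphism classes of continuous irreducible
`d`-dimensional complex representations of `H`. -/
noncomputable def repDimCard (H : Type) [Group H] [TopologicalSpace H] (d : ℕ) : Cardinal :=
  Cardinal.mk (Quot (repIso (H := H) (d := d)))

open Matrix

lemma inv_aux {V : Type} [AddCommGroup V] [Module ℂ V] [FiniteDimensional ℂ V]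
    (W : Submodule ℂ V) (hW : W ≠ ⊥) (a b : Module.End ℂ V)
    (ha : ∀ w ∈ W, a w ∈ W) (hb : ∀ w ∈ W, b w ∈ W)
    (hbi : Function.Injective b) (hai : Function.Injective a)
    (hab : ∀ w ∈ W, a (b w) = - b (a w)) :
    ∃ W' : Submodule ℂ V, W' ≤ W ∧ W' ≠ ⊥ ∧
      2 * Module.finrank ℂ W' ≤ Module.finrank ℂ W ∧
      ∀ c : Module.End ℂ V, (∀ w ∈ W, c w ∈ W) → a * c = c * a → ∀ w ∈ W', c w ∈ W' := by
  haveI : Nontrivial W := Submodule.nontrivial_iff_ne_bot.mpr hW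
  obtain ⟨l, hl⟩ := Module.End.exists_eigenvalue (K := ℂ) (a.restrict ha)
  obtain ⟨v, hv⟩ := hl.exists_hasEigenvector
  have hv1 : a (v : V) = l • (v : V) := by
    have := congrArg Subtype.val hv.apply_eq_smul
    simpa using this
  have hv0 : (v : V) ≠ 0 := by
    have := hv.2
    simpa using this
  have hl0 : l ≠ 0 := by
    rintro rfl
    apply hv0
    apply hai
    simpa using hv1
  let E : Submodule ℂ V := W ⊓ LinearMap.ker (a - l • (1 : Module.End ℂ V))
  have hE : ∀ x, x ∈ E ↔ x ∈ W ∧ a x = l • x := by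
    intro x
    simp [E, sub_eq_zero]
  refine ⟨E, inf_le_left, ?_, ?_, ?_⟩
  · intro h
    have : (v : V) ∈ E := (hE _).2 ⟨v.2, hv1⟩
    rw [h] at this
    exact hv0 (by simpa using this)
  · have hF : ∀ x ∈ E.map b, x ∈ W ∧ a x = -(l • x) := by
      rintro x ⟨y, hy, rfl⟩
      have hy' := (hE y).1 hy
      refine ⟨hb _ hy'.1, ?_⟩
      rw [hab _ hy'.1, hy'.2, map_smul]
    have hd : E ⊓ E.map b = ⊥ := by
      rw [eq_bot_iff]
      rintro x ⟨h1, h2⟩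
      have e1 := ((hE x).1 h1).2
      have e2 := (hF x h2).2
      have : (2 * l) • x = 0 := by
        have h3 : l • x = -(l • x) := e1.symm.trans e2
        rw [mul_smul, two_smul]
        nth_rewrite 1 [h3]
        simp
      rcases smul_eq_zero.1 this with h | h
      · simp [hl0] at h
      · simpa using h
    have hle : E ⊔ E.map b ≤ W := sup_le inf_le_left (fun x hx => (hF x hx).1)
    have h1 := Submodule.finrank_sup_add_finrank_inf_eq E (E.map b)
    rw [hd, finrank_bot] at h1
    have h2 := Submodule.finrank_mono hle
    have h3 : Module.finrank ℂ (E.map b) = Module.finrank ℂ E :=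
      (Submodule.equivMapOfInjective b hbi E).finrank_eq.symm
    omega
  · intro c hc hac w hw
    have hw' := (hE w).1 hw
    refine (hE _).2 ⟨hc _ hw'.1, ?_⟩
    have : a (c w) = c (a w) := LinearMap.congr_fun hac w
    rw [this, hw'.2, map_smul]

lemma eight_le {V : Type} [AddCommGroup V] [Module ℂ V] [FiniteDimensional ℂ V]
    (z : Module.End ℂ V) (a b : Fin 3 → Module.End ℂ V)
    (hz1 : z ≠ 1) (hz2 : z * z = 1)
    (hza : ∀ k, z * a k = a k * z) (hzb : ∀ k, z * b k = b k * z)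
    (hab : ∀ k, a k * b k = z * (b k * a k))
    (haa : ∀ k l, a k * a l = a l * a k)
    (habc : ∀ k l, k ≠ l → a k * b l = b l * a k)
    (hai : ∀ k, Function.Injective (a k)) (hbi : ∀ k, Function.Injective (b k)) :
    8 ≤ Module.finrank ℂ V := by
  let W : Submodule ℂ V := LinearMap.ker (z + 1)
  have hWm : ∀ x, x ∈ W ↔ z x = -x := by
    intro x
    simp [W, add_eq_zero_iff_eq_neg]
  have hW : W ≠ ⊥ := by
    intro h
    apply hz1
    ext x
    have : z x - x ∈ W := by
      rw [hWm, map_sub]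
      have : z (z x) = x := LinearMap.congr_fun hz2 x
      rw [this]; abel
    rw [h, Submodule.mem_bot, sub_eq_zero] at this
    simpa using this
  have inv : ∀ c : Module.End ℂ V, z * c = c * z → ∀ w ∈ W, c w ∈ W := by
    intro c hc w hw
    rw [hWm] at *
    have : z (c w) = c (z w) := LinearMap.congr_fun hc w
    rw [this, hw, map_neg]
  have anti : ∀ k, ∀ w ∈ W, a k (b k w) = - b k (a k w) := by
    intro k w hw
    have h1 : a k (b k w) = z (b k (a k w)) := LinearMap.congr_fun (hab k) w
    rw [h1]
    exact (hWm _).1 (inv _ (hzb k) _ (inv _ (hza k) _ hw))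
  obtain ⟨W1, l1, n1, d1, c1⟩ := inv_aux W hW (a 0) (b 0) (inv _ (hza 0)) (inv _ (hzb 0))
    (hbi 0) (hai 0) (anti 0)
  have ia1 : ∀ k, ∀ w ∈ W1, a k w ∈ W1 := fun k => c1 _ (inv _ (hza k)) (haa _ _)
  have ib1 : ∀ k, k ≠ 0 → ∀ w ∈ W1, b k w ∈ W1 :=
    fun k hk => c1 _ (inv _ (hzb k)) (habc _ _ hk.symm)
  obtain ⟨W2, l2, n2, d2, c2⟩ := inv_aux W1 n1 (a 1) (b 1) (ia1 1) (ib1 1 (by decide))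
    (hbi 1) (hai 1) (fun w hw => anti 1 w (l1 hw))
  obtain ⟨W3, l3, n3, d3, c3⟩ := inv_aux W2 n2 (a 2) (b 2) (c2 _ (ia1 2) (haa _ _))
    (c2 _ (ib1 2 (by decide)) (habc _ _ (by decide)))
    (hbi 2) (hai 2) (fun w hw => anti 2 w (l1 (l2 hw)))
  have h3 : 1 ≤ Module.finrank ℂ W3 := Submodule.one_le_finrank_iff.2 n3
  have := Submodule.finrank_le W
  omega

/-- The central embedding of signs in `SU(2)`. -/
noncomputable def eps : ℤˣ →* SU2 where
  toFun u := ⟨⟨((u : ℤ) : ℂ) • (1 : Matrix (Fin 2) (Fin 2) ℂ), by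
    rw [Matrix.mem_unitaryGroup_iff]
    rcases Int.units_eq_one_or u with rfl | rfl <;> simp⟩, by
    change Matrix.det (((u : ℤ) : ℂ) • (1 : Matrix (Fin 2) (Fin 2) ℂ)) = 1
    rcases Int.units_eq_one_or u with rfl | rfl <;> simp [Matrix.det_fin_two]⟩
  map_one' := by
    apply Subtype.ext; apply Subtype.ext; simp
  map_mul' u v := by
    apply Subtype.ext; apply Subtype.ext
    simp [smul_smul, mul_comm]

lemma su2_ext' {x y : SU2} (h : (SU2.toMatrix x) = (SU2.toMatrix y)) : x = y :=
  Subtype.ext (Subtype.ext h)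

lemma su2_toMatrix_mul (x y : SU2) : (SU2.toMatrix (x * y)) = (SU2.toMatrix x) * (SU2.toMatrix y) := rfl

lemma su2_toMatrix_one : (SU2.toMatrix (1 : SU2)) = 1 := rfl

lemma su2_det_toMatrix (x : SU2) : (SU2.toMatrix x).det = 1 := x.2

lemma eps_toMatrix (u : ℤˣ) : (SU2.toMatrix (eps u)) = ((u : ℤ) : ℂ) • 1 := rfl

lemma eps_comm (u : ℤˣ) (x : SU2) : eps u * x = x * eps u := by
  apply su2_ext'
  simp [su2_toMatrix_mul, eps_toMatrix]

lemma eps_inj : Function.Injective eps := by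
  intro u v h
  have := congrArg SU2.toMatrix h
  rw [eps_toMatrix, eps_toMatrix] at this
  have := congrFun (congrFun this 0) 0
  simp at this
  exact Units.ext (by exact_mod_cast this)

abbrev GG := Fin 6 → SU2
abbrev SS := Fin 6 → ℤˣ

/-- Signs in the sixfold product. -/
noncomputable def Eps : SS →* GG where
  toFun s i := eps (s i)
  map_one' := by ext1 i; simp
  map_mul' s t := by ext1 i; simp

lemma Eps_comm (s : SS) (g : GG) : Eps s * g = g * Eps s := by
  funext i; exact eps_comm _ _

def C1 : Subgroup SS where
  carrier := {s | s 0 = s 1 ∧ s 2 = s 3 ∧ s 4 = s 5}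
  one_mem' := by simp
  mul_mem' := by
    rintro a b ⟨h1, h2, h3⟩ ⟨h4, h5, h6⟩
    simp [*]
  inv_mem' := by
    rintro a ⟨h1, h2, h3⟩
    simp [*]

def C2 : Subgroup SS where
  carrier := {s | s 3 = s 4 ∧ s 4 = s 5 ∧ s 0 * s 1 * s 2 * s 3 = 1}
  one_mem' := by simp
  mul_mem' := by
    rintro a b ⟨h1, h2, h3⟩ ⟨h4, h5, h6⟩
    refine ⟨by simp [*], by simp [*], ?_⟩
    calc _ = (a 0 * a 1 * a 2 * a 3) * (b 0 * b 1 * b 2 * b 3) := by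
          simp only [Pi.mul_apply]; ac_rfl
      _ = 1 := by rw [h3, h6, one_mul]
  inv_mem' := by
    rintro a ⟨h1, h2, h3⟩
    refine ⟨by simp [*], by simp [*], ?_⟩
    calc _ = (a 0 * a 1 * a 2 * a 3)⁻¹ := by
          simp only [Pi.inv_apply, mul_inv]
      _ = 1 := by rw [h3, inv_one]

noncomputable def ZZ (C : Subgroup SS) : Subgroup GG := C.map Eps

lemma ZZ_le (C : Subgroup SS) : ZZ C ≤ Subgroup.center GG := by
  rintro _ ⟨s, -, rfl⟩
  rw [Subgroup.mem_center_iff]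
  intro g
  exact (Eps_comm s g).symm

instance ZZ_normal (C : Subgroup SS) : (ZZ C).Normal where
  conj_mem := by
    intro n hn g
    have := Subgroup.mem_center_iff.1 (ZZ_le C hn) g
    rw [this, mul_inv_cancel_right]
    exact hn

/-- The distinguishing property. -/
def PP (H : Type) [Group H] : Prop :=
  ∃ (z : H) (a b : Fin 3 → H), z ≠ 1 ∧ z * z = 1 ∧ (∀ h, z * h = h * z) ∧
    (∀ k, a k * b k = z * (b k * a k)) ∧ (∀ k l, a k * a l = a l * a k) ∧
    (∀ k l, k ≠ l → a k * b l = b l * a k)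

lemma PP_equiv {H K : Type} [Group H] [Group K] (e : H ≃* K) (h : PP H) : PP K := by
  obtain ⟨z, a, b, h1, h2, h3, h4, h5, h6⟩ := h
  refine ⟨e z, fun k => e (a k), fun k => e (b k), ?_, ?_, ?_, ?_, ?_, ?_⟩
  · simpa using h1
  · rw [← map_mul, h2, map_one]
  · intro h
    obtain ⟨h, rfl⟩ := e.surjective h
    rw [← map_mul, h3, map_mul]
  · intro k; simp only [← map_mul, h4]
  · intro k l; simp only [← map_mul, h5 k l]
  · intro k l hkl; simp only [← map_mul, h6 k l hkl]

def qi : SU2 := ⟨⟨!![Complex.I, 0; 0, -Complex.I], by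
    rw [Matrix.mem_unitaryGroup_iff]
    ext i j; fin_cases i <;> fin_cases j <;> simp [Matrix.mul_apply, Fin.sum_univ_two, Matrix.star_apply]⟩, by
    change Matrix.det (!![Complex.I, 0; 0, -Complex.I] : Matrix (Fin 2) (Fin 2) ℂ) = 1
    simp [Matrix.det_fin_two]⟩

def qj : SU2 := ⟨⟨!![0, 1; -1, 0], by
    rw [Matrix.mem_unitaryGroup_iff]
    ext i j; fin_cases i <;> fin_cases j <;> simp [Matrix.mul_apply, Fin.sum_univ_two, Matrix.star_apply]⟩, by
    change Matrix.det (!![0, 1; -1, 0] : Matrix (Fin 2) (Fin 2) ℂ) = 1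
    simp [Matrix.det_fin_two]⟩

lemma qiqj : qi * qj = eps (-1) * (qj * qi) := by
  apply su2_ext'
  simp only [su2_toMatrix_mul, eps_toMatrix]
  change !![Complex.I, 0; 0, -Complex.I] * !![0, 1; -1, 0] =
    _ * ((!![0, 1; -1, 0] : Matrix (Fin 2) (Fin 2) ℂ) * !![Complex.I, 0; 0, -Complex.I])
  ext i j; fin_cases i <;> fin_cases j <;> simp

lemma Eps_mulSingle (i : Fin 6) (u : ℤˣ) : Eps (Pi.mulSingle i u) = Pi.mulSingle i (eps u) := by
  funext j
  change eps ((Pi.mulSingle i u : SS) j) = _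
  rcases eq_or_ne j i with rfl | h
  · simp
  · simp [h]

lemma Eps_inj : Function.Injective Eps := by
  intro s t h
  funext i
  exact eps_inj (congrFun h i)

lemma mem_ZZ (C : Subgroup SS) (s : SS) : Eps s ∈ ZZ C ↔ s ∈ C :=
  Subgroup.mem_map_iff_mem Eps_inj

lemma ms_comm (k l : Fin 6) (h : k ≠ l) (x y : SU2) :
    (Pi.mulSingle k x : GG) * Pi.mulSingle l y = Pi.mulSingle l y * Pi.mulSingle k x :=
  by
  funext j
  simp only [Pi.mul_apply, Pi.mulSingle_apply]
  split_ifs with h1 h2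
  · exact absurd (h1.symm.trans h2) h
  all_goals simp

lemma PP2 : PP (GG ⧸ ZZ C2) := by
  let ι : Fin 3 → Fin 6 := Fin.castLE (by decide)
  have hι : Function.Injective ι := Fin.castLE_injective _
  let m : GG →* GG ⧸ ZZ C2 := QuotientGroup.mk' (ZZ C2)
  refine ⟨m (Eps (Pi.mulSingle 0 (-1))), fun k => m (Pi.mulSingle (ι k) qi),
    fun k => m (Pi.mulSingle (ι k) qj), ?_, ?_, ?_, ?_, ?_, ?_⟩
  · intro h
    have h := (QuotientGroup.eq_one_iff _).1 h
    rw [mem_ZZ] at h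
    have := h.2.2
    revert this
    decide
  · rw [← map_mul, ← map_mul, ← Pi.mulSingle_mul]; simp
  · intro h
    obtain ⟨g, rfl⟩ := QuotientGroup.mk'_surjective _ h
    change m _ * m g = m g * m _
    rw [← map_mul, Eps_comm, map_mul]
  · intro k
    have h1 : m (Eps (Pi.mulSingle 0 (-1))) = m (Eps (Pi.mulSingle (ι k) (-1))) := by
      apply QuotientGroup.eq.2
      rw [← map_inv, ← map_mul, mem_ZZ]
      revert k
      change ∀ k, _ ∧ _ ∧ _
      decide
    rw [h1, Eps_mulSingle, ← map_mul, ← map_mul, ← map_mul, ← Pi.mulSingle_mul,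
      ← Pi.mulSingle_mul, ← Pi.mulSingle_mul, qiqj]
  · intro k l
    rcases eq_or_ne k l with rfl | h
    · rfl
    · simp only [← map_mul]
      rw [ms_comm _ _ (hι.ne h)]
  · intro k l h
    simp only [← map_mul]
    rw [ms_comm _ _ (hι.ne h)]

/-- The action on `2 × 2` matrices through two of the factors. -/
noncomputable def TT (p q : Fin 6) : GG →* Module.End ℂ (Matrix (Fin 2) (Fin 2) ℂ) where
  toFun g := LinearMap.mulLeft ℂ (SU2.toMatrix (g p)) * LinearMap.mulRight ℂ (SU2.toMatrix (g q)⁻¹)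
  map_one' := by
    ext1 X; simp [su2_toMatrix_one]
  map_mul' g h := by
    ext1 X; simp [su2_toMatrix_mul, mul_assoc]

lemma TT_apply (p q : Fin 6) (g : GG) (X : Matrix (Fin 2) (Fin 2) ℂ) :
    TT p q g X = (SU2.toMatrix (g p)) * (X * (SU2.toMatrix (g q)⁻¹)) := rfl

lemma TT_eq_one (p q : Fin 6) (g : GG) (h : TT p q g = 1) :
    ∃ u : ℤˣ, g p = eps u ∧ g q = eps u := by
  have hX : ∀ X, (SU2.toMatrix (g p)) * X = X * (SU2.toMatrix (g q)) := by
    intro X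
    have h1 : (SU2.toMatrix (g p)) * (X * (SU2.toMatrix (g q)⁻¹)) = X := LinearMap.congr_fun h X
    calc _ = (SU2.toMatrix (g p)) * (X * ((SU2.toMatrix (g q)⁻¹) * (SU2.toMatrix (g q)))) := by
          rw [← su2_toMatrix_mul, inv_mul_cancel, su2_toMatrix_one, mul_one]
      _ = ((SU2.toMatrix (g p)) * (X * (SU2.toMatrix (g q)⁻¹))) * (SU2.toMatrix (g q)) := by
          simp only [mul_assoc]
      _ = _ := by rw [h1]
  have e : g q = g p := by
    apply su2_ext'
    simpa using (hX 1).symm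
  rw [e] at hX
  have e1 := hX !![0, 1; 0, 0]
  have e2 := hX !![0, 0; 1, 0]
  have hd := su2_det_toMatrix (g p)
  rw [e]
  suffices ∃ u : ℤˣ, g p = eps u by simpa using this
  generalize g p = x at *
  have a1 := congrFun (congrFun e1 0) 0
  have a2 := congrFun (congrFun e1 0) 1
  have a3 := congrFun (congrFun e1 1) 1
  simp [Matrix.mul_apply, Fin.sum_univ_two] at a1 a2 a3
  have b1 := congrFun (congrFun e2 0) 0
  simp [Matrix.mul_apply, Fin.sum_univ_two] at b1
  rw [Matrix.det_fin_two, a3, ← a2] at hd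
  have : ((SU2.toMatrix x) 0 0 - 1) * ((SU2.toMatrix x) 0 0 + 1) = 0 := by linear_combination hd
  rcases mul_eq_zero.1 this with h | h
  · refine ⟨1, su2_ext' ?_⟩
    have h := sub_eq_zero.1 h
    have h' := a2.symm.trans h
    rw [eps_toMatrix]
    ext i j; fin_cases i <;> fin_cases j <;> simp [a3, b1, h, h']
  · refine ⟨-1, su2_ext' ?_⟩
    have h := eq_neg_of_add_eq_zero_left h
    have h' := a2.symm.trans h
    rw [eps_toMatrix]
    ext i j; fin_cases i <;> fin_cases j <;> simp [a3, b1, h, h']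

lemma TT_Eps (p q : Fin 6) (s : SS) (h : s p = s q) : TT p q (Eps s) = 1 := by
  ext1 X
  rw [TT_apply]
  change (SU2.toMatrix (eps (s p))) * (X * (SU2.toMatrix (eps (s q))⁻¹)) = X
  rw [h, ← map_inv, eps_toMatrix, eps_toMatrix]
  rcases Int.units_eq_one_or (s q) with e | e <;> simp [e]

lemma PP1_aux (p q : Fin 6) (hpq : ∀ s ∈ C1, s p = s q) (z : GG ⧸ ZZ C1) (a b : Fin 3 → GG ⧸ ZZ C1)
    (h2 : z * z = 1) (h3 : ∀ h, z * h = h * z)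
    (h4 : ∀ k, a k * b k = z * (b k * a k)) (h5 : ∀ k l, a k * a l = a l * a k)
    (h6 : ∀ k l, k ≠ l → a k * b l = b l * a k) (g : GG) (hg : (g : GG ⧸ ZZ C1) = z) :
    TT p q g = 1 := by
  let T : GG ⧸ ZZ C1 →* Module.End ℂ (Matrix (Fin 2) (Fin 2) ℂ) :=
    QuotientGroup.lift (ZZ C1) (TT p q) (by
      rintro _ ⟨s, hs, rfl⟩
      exact TT_Eps p q s (hpq s hs))
  have hT : T z = TT p q g := by rw [← hg]; rfl
  have hinj : ∀ x, Function.Injective (T x) := by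
    intro x
    apply Function.LeftInverse.injective (g := T x⁻¹)
    intro v
    change (T x⁻¹ * T x) v = v
    rw [← map_mul, inv_mul_cancel, map_one]; rfl
  by_contra hne
  have := eight_le (T z) (fun k => T (a k)) (fun k => T (b k)) (by rwa [hT])
    (by rw [← map_mul, h2, map_one]) (fun k => by rw [← map_mul, h3, map_mul])
    (fun k => by rw [← map_mul, h3, map_mul]) (fun k => by simp only [← map_mul, h4])
    (fun k l => by simp only [← map_mul, h5 k l])
    (fun k l hkl => by simp only [← map_mul, h6 k l hkl]) (fun k => hinj _) (fun k => hinj _)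
  rw [Module.finrank_matrix] at this
  simp at this

lemma not_PP1 : ¬ PP (GG ⧸ ZZ C1) := by
  rintro ⟨z, a, b, h1, h2, h3, h4, h5, h6⟩
  obtain ⟨g, hg⟩ := QuotientGroup.mk_surjective z
  obtain ⟨u, hu0, hu1⟩ := TT_eq_one 0 1 g
    (PP1_aux 0 1 (fun s hs => hs.1) z a b h2 h3 h4 h5 h6 g hg)
  obtain ⟨v, hv0, hv1⟩ := TT_eq_one 2 3 g
    (PP1_aux 2 3 (fun s hs => hs.2.1) z a b h2 h3 h4 h5 h6 g hg)
  obtain ⟨w, hw0, hw1⟩ := TT_eq_one 4 5 g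
    (PP1_aux 4 5 (fun s hs => hs.2.2) z a b h2 h3 h4 h5 h6 g hg)
  apply h1
  rw [← hg]
  apply (QuotientGroup.eq_one_iff _).2
  refine ⟨![u, u, v, v, w, w], ⟨rfl, rfl, rfl⟩, ?_⟩
  funext i
  change eps (![u, u, v, v, w, w] i) = g i
  fin_cases i <;> simp [*]

def pair (c u : ℤˣ) : ℤˣ := if c = 1 then 1 else u

def sig (c : SS) : Equiv.Perm (Fin 6) :=
  if c 0 ≠ c 2 ∧ c 0 ≠ c 4 then Equiv.swap 0 3 * Equiv.swap 1 4
  else if c 2 ≠ c 0 ∧ c 2 ≠ c 4 then Equiv.swap 2 5 else 1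

def D1 (c : SS) : Prop := c 0 = c 1 ∧ c 2 = c 3 ∧ c 4 = c 5

def D2 (c : SS) : Prop := c 0 = c 1 ∧ c 1 = c 2 ∧ c 2 = c 3 * c 4 * c 5

instance : DecidablePred D1 := fun c => by unfold D1; infer_instance

instance : DecidablePred D2 := fun c => by unfold D2; infer_instance

def FF (c : SS) : SS := fun i => c (sig c i)

def DD (C : Subgroup SS) (c : SS) : Prop := ∀ s ∈ C, ∏ i, pair (c i) (s i) = 1

set_option maxRecDepth 100000 in
lemma sig_sig : ∀ c i, sig c (sig c i) = i := by decide +kernel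

set_option maxRecDepth 100000 in
lemma FF_mem : ∀ c, D1 c → D2 (FF c) := by decide +kernel

set_option maxRecDepth 100000 in
lemma FF_inj : ∀ c, D1 c → ∀ c', D1 c' → FF c = FF c' → c = c' := by decide +kernel

set_option maxRecDepth 100000 in
lemma FF_surj : ∀ c, D2 c → ∃ c', D1 c' ∧ FF c' = c := by decide +kernel

set_option maxRecDepth 100000 in
lemma DD1 : ∀ c, DD C1 c ↔ D1 c := by
  change ∀ c : SS, (∀ s : SS, (s 0 = s 1 ∧ s 2 = s 3 ∧ s 4 = s 5) →
    ∏ i, pair (c i) (s i) = 1) ↔ D1 c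
  decide +kernel

set_option maxRecDepth 100000 in
lemma DD2 : ∀ c, DD C2 c ↔ D2 c := by
  change ∀ c : SS, (∀ s : SS, (s 3 = s 4 ∧ s 4 = s 5 ∧ s 0 * s 1 * s 2 * s 3 = 1) →
    ∏ i, pair (c i) (s i) = 1) ↔ D2 c
  decide +kernel

lemma pair_mul (c u v : ℤˣ) : pair c (u * v) = pair c u * pair c v := by
  unfold pair; split_ifs <;> simp

lemma repIso_equiv {H : Type} [Group H] [TopologicalSpace H] {d : ℕ} :
    Equivalence (repIso (H := H) (d := d)) where
  refl r := ⟨1, fun g => by simp⟩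
  symm := by
    rintro r s ⟨P, h⟩
    refine ⟨P⁻¹, fun g => ?_⟩
    rw [inv_mul_eq_iff_eq_mul, ← mul_assoc, h, mul_inv_cancel_right]
  trans := by
    rintro r s t ⟨P, h⟩ ⟨Q, k⟩
    refine ⟨Q * P, fun g => ?_⟩
    rw [mul_assoc, h, ← mul_assoc, k, mul_assoc]

lemma repIso_exact {H : Type} [Group H] [TopologicalSpace H] {d : ℕ} {r s : IrredRep H d}
    (h : Quot.mk repIso r = Quot.mk repIso s) : repIso r s :=
  repIso_equiv.eqvGen_iff.1 (Quot.eqvGen_exact h)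

/-- Pullback along a continuous surjection. -/
def pull {H K : Type} [Group H] [TopologicalSpace H] [Group K] [TopologicalSpace K] {d : ℕ}
    (f : H →* K) (hf : Continuous f) (hs : Function.Surjective f) (r : IrredRep K d) :
    IrredRep H d :=
  ⟨r.1.comp f, r.2.1.comp hf, fun W hW => r.2.2 W (fun g v hv => by
    obtain ⟨h, rfl⟩ := hs g
    exact hW h v hv)⟩

/-- Signs as matrices. -/
def JJ (d : ℕ) : ℤˣ →* (Matrix (Fin d) (Fin d) ℂ)ˣ :=
  Units.map (Int.castRingHom (Matrix (Fin d) (Fin d) ℂ)).toMonoidHom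

lemma JJ_neg_one (d : ℕ) : JJ d (-1) = -1 := by
  ext1; simp [JJ]

open Classical in
/-- The central character. -/
noncomputable def chi {d : ℕ} (r : IrredRep GG d) : SS := fun i =>
  if r.1 (Eps (Pi.mulSingle i (-1))) = 1 then 1 else -1

lemma schur {d : ℕ} {H : Type} [Group H] [TopologicalSpace H] (r : IrredRep H d) (z : H)
    (hz : z * z = 1) (hc : ∀ h, z * h = h * z) : r.1 z = 1 ∨ r.1 z = -1 := by
  have hM2 : (r.1 z : Matrix (Fin d) (Fin d) ℂ) * (r.1 z : Matrix (Fin d) (Fin d) ℂ) = 1 := by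
    rw [← Units.val_mul, ← map_mul, hz, map_one, Units.val_one]
  have hMc : ∀ g, (r.1 z : Matrix (Fin d) (Fin d) ℂ) * (r.1 g : Matrix (Fin d) (Fin d) ℂ)
      = (r.1 g : Matrix (Fin d) (Fin d) ℂ) * (r.1 z : Matrix (Fin d) (Fin d) ℂ) := by
    intro g
    rw [← Units.val_mul, ← map_mul, hc, map_mul, Units.val_mul]
  have key : ∀ M : Matrix (Fin d) (Fin d) ℂ, (r.1 z : Matrix (Fin d) (Fin d) ℂ) = M →
      M = 1 ∨ M = -1 := by
    intro M hM
    rw [hM] at hM2 hMc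
    let W : Submodule ℂ (Fin d → ℂ) := LinearMap.ker (Matrix.mulVecLin M - 1)
    have hW : ∀ v, v ∈ W ↔ M *ᵥ v = v := by
      intro v; simp [W, sub_eq_zero]
    rcases r.2.2 W (by
      intro g v hv
      rw [hW] at *
      rw [Matrix.mulVec_mulVec, hMc, ← Matrix.mulVec_mulVec, hv]) with h | h
    · right
      apply Matrix.ext_of_mulVec_single
      intro i
      have : M *ᵥ (Pi.single i 1) + Pi.single i 1 ∈ W := by
        rw [hW, Matrix.mulVec_add, Matrix.mulVec_mulVec, hM2, Matrix.one_mulVec, add_comm]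
      rw [h, Submodule.mem_bot] at this
      rw [Matrix.neg_mulVec, Matrix.one_mulVec]
      exact eq_neg_of_add_eq_zero_left this
    · left
      apply Matrix.ext_of_mulVec_single
      intro i
      rw [Matrix.one_mulVec, ← hW, h]
      trivial
  rcases key _ rfl with h | h
  · left; exact Units.ext h
  · right; exact Units.ext (by simpa using h)

lemma rep_single {d : ℕ} (r : IrredRep GG d) (i : Fin 6) (u : ℤˣ) :
    r.1 (Eps (Pi.mulSingle i u)) = JJ d (pair (chi r i) u) := by
  have hs := schur r (Eps (Pi.mulSingle i (-1))) (by
    rw [← map_mul, ← Pi.mulSingle_mul]; simp) (Eps_comm _)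
  rcases Int.units_eq_one_or u with rfl | rfl
  · unfold pair; split_ifs <;> simp
  · unfold chi pair
    by_cases h : r.1 (Eps (Pi.mulSingle i (-1))) = 1
    · simp [h]
    · rw [if_neg h, if_neg (by decide), JJ_neg_one]
      tauto

lemma rep_Eps {d : ℕ} (r : IrredRep GG d) (s : SS) :
    r.1 (Eps s) = JJ d (∏ i, pair (chi r i) (s i)) := by
  let F : SS →* ℤˣ :=
    { toFun := fun s => ∏ i, pair (chi r i) (s i)
      map_one' := by simp [pair]
      map_mul' := fun s t => by simp [pair_mul, Finset.prod_mul_distrib] }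
  have : r.1.comp Eps = (JJ d).comp F := by
    refine MonoidHom.pi_ext (M := fun _ : Fin 6 => ℤˣ) (fun i u => ?_)
    change r.1 (Eps (Pi.mulSingle i u)) = JJ d (∏ j, pair (chi r j) ((Pi.mulSingle i u : SS) j))
    rw [rep_single]
    congr 1
    rw [Finset.prod_eq_single i]
    · simp
    · intro j _ hj
      simp [hj, pair]
    · simp
  exact DFunLike.congr_fun this s

lemma trivial_iff {d : ℕ} (C : Subgroup SS) (r : IrredRep GG d) :
    (∀ z ∈ ZZ C, r.1 z = 1) ↔ DD C (chi r) := by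
  constructor
  · intro h s hs
    have h1 := h _ ((mem_ZZ C s).2 hs)
    rcases Nat.eq_zero_or_pos d with rfl | hd
    · have : ∀ i, chi r i = 1 := fun i => if_pos (Subsingleton.elim _ _)
      simp [this, pair]
    · rw [rep_Eps] at h1
      rcases Int.units_eq_one_or (∏ i, pair (chi r i) (s i)) with e | e
      · exact e
      · exfalso
        rw [e, JJ_neg_one] at h1
        have := congrArg (fun M : (Matrix (Fin d) (Fin d) ℂ)ˣ => M.val ⟨0, hd⟩ ⟨0, hd⟩) h1
        simp at this
        norm_num at this
  · rintro h _ ⟨s, hs, rfl⟩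
    rw [rep_Eps, h s hs, map_one]

lemma chi_iso {d : ℕ} (r s : IrredRep GG d) (h : repIso r s) : chi r = chi s := by
  obtain ⟨P, h⟩ := h
  funext i
  unfold chi
  have : r.1 (Eps (Pi.mulSingle i (-1))) = 1 ↔ s.1 (Eps (Pi.mulSingle i (-1))) = 1 := by
    have := h (Eps (Pi.mulSingle i (-1)))
    constructor
    · intro e
      rw [e, mul_one] at this
      exact mul_right_cancel (this.symm.trans (one_mul P).symm)
    · intro e
      rw [e, one_mul] at this
      exact mul_left_cancel (this.trans (mul_one P).symm)
  simp only [this]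

noncomputable def chiQ {d : ℕ} : Quot (repIso (H := GG) (d := d)) → SS :=
  Quot.lift chi chi_iso

lemma card_quot (C : Subgroup SS) (d : ℕ) : repDimCard (GG ⧸ ZZ C) d =
    Cardinal.mk {q : Quot (repIso (H := GG) (d := d)) // DD C (chiQ q)} := by
  let m : GG →* GG ⧸ ZZ C := QuotientGroup.mk' (ZZ C)
  have hm : Continuous m := continuous_quotient_mk'
  have hs : Function.Surjective m := QuotientGroup.mk'_surjective _
  let Φ : Quot (repIso (H := GG ⧸ ZZ C) (d := d)) →
      {q : Quot (repIso (H := GG) (d := d)) // DD C (chiQ q)} :=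
    Quot.lift (fun r => ⟨Quot.mk _ (pull m hm hs r), by
      change DD C (chi _)
      rw [← trivial_iff]
      intro z hz
      change r.1 (m z) = 1
      have : m z = 1 := (QuotientGroup.eq_one_iff z).2 hz
      rw [this, map_one]⟩) (by
      rintro r s ⟨P, h⟩
      apply Subtype.ext
      exact Quot.sound ⟨P, fun g => h (m g)⟩)
  refine Cardinal.mk_congr (Equiv.ofBijective Φ ⟨?_, ?_⟩)
  · intro x y
    induction x using Quot.ind with | _ r
    induction y using Quot.ind with | _ s
    intro h
    obtain ⟨P, h⟩ := repIso_exact (congrArg Subtype.val h)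
    refine Quot.sound ⟨P, fun g => ?_⟩
    obtain ⟨g, rfl⟩ := hs g
    exact h g
  · rintro ⟨q, hq⟩
    induction q using Quot.ind with | _ r
    have hq' := (trivial_iff C r).2 hq
    refine ⟨Quot.mk _ ⟨QuotientGroup.lift (ZZ C) r.1 hq', ?_, ?_⟩, ?_⟩
    · have hq : Topology.IsQuotientMap m := QuotientGroup.isQuotientMap_mk _
      rw [hq.continuous_iff]
      exact r.2.1
    · intro W hW
      exact r.2.2 W (fun g v hv => hW (m g) v hv)
    · apply Subtype.ext
      exact Quot.sound ⟨1, fun g => by rw [one_mul, mul_one]; rfl⟩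

/-- Permutation of the factors. -/
noncomputable def perm (σ : Equiv.Perm (Fin 6)) : GG →* GG where
  toFun g i := g (σ i)
  map_one' := rfl
  map_mul' _ _ := rfl

lemma perm_cont (σ : Equiv.Perm (Fin 6)) : Continuous (perm σ) :=
  continuous_pi fun i => continuous_apply (σ i)

lemma perm_surj (σ : Equiv.Perm (Fin 6)) : Function.Surjective (perm σ) := fun g =>
  ⟨fun i => g (σ.symm i), funext fun i => by simp [perm]⟩

noncomputable def permQ {d : ℕ} (σ : Equiv.Perm (Fin 6)) :
    Quot (repIso (H := GG) (d := d)) → Quot (repIso (H := GG) (d := d)) :=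
  Quot.map (pull (perm σ) (perm_cont σ) (perm_surj σ)) (by
    rintro r s ⟨P, h⟩
    exact ⟨P, fun g => h _⟩)

lemma permQ_permQ {d : ℕ} (σ : Equiv.Perm (Fin 6)) (hσ : ∀ i, σ (σ i) = i)
    (q : Quot (repIso (H := GG) (d := d))) : permQ σ (permQ σ q) = q := by
  induction q using Quot.ind with | _ r
  refine Quot.sound ⟨1, fun g => ?_⟩
  rw [one_mul, mul_one]
  change r.1 (fun i => g (σ (σ i))) = _
  simp only [hσ]

lemma chiQ_permQ {d : ℕ} (σ : Equiv.Perm (Fin 6)) (hσ : ∀ i, σ (σ i) = i)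
    (q : Quot (repIso (H := GG) (d := d))) : chiQ (permQ σ q) = fun i => chiQ q (σ i) := by
  induction q using Quot.ind with | _ r
  funext i
  change chi (pull _ _ _ r) i = chi r (σ i)
  unfold chi
  have : perm σ (Eps (Pi.mulSingle i (-1))) = Eps (Pi.mulSingle (σ i) (-1)) := by
    funext j
    change eps ((Pi.mulSingle i (-1) : SS) (σ j)) = eps ((Pi.mulSingle (σ i) (-1) : SS) j)
    congr 1
    simp only [Pi.mulSingle_apply]
    have : σ j = i ↔ j = σ i := ⟨fun h => by rw [← h, hσ], fun h => by rw [h, hσ]⟩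
    simp only [this]
  change (if r.1 (perm σ (Eps (Pi.mulSingle i (-1)))) = 1 then _ else _) = _
  rw [this]

lemma cards (d : ℕ) : repDimCard (GG ⧸ ZZ C1) d = repDimCard (GG ⧸ ZZ C2) d := by
  rw [card_quot, card_quot]
  have hF : ∀ q : Quot (repIso (H := GG) (d := d)),
      chiQ (permQ (sig (chiQ q)) q) = FF (chiQ q) := fun q => chiQ_permQ _ (sig_sig _) q
  let Φ : {q : Quot (repIso (H := GG) (d := d)) // DD C1 (chiQ q)} →
      {q : Quot (repIso (H := GG) (d := d)) // DD C2 (chiQ q)} := fun q =>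
    ⟨permQ (sig (chiQ q.1)) q.1, by
      rw [hF, DD2]
      exact FF_mem _ ((DD1 _).1 q.2)⟩
  refine Cardinal.mk_congr (Equiv.ofBijective Φ ⟨?_, ?_⟩)
  · rintro ⟨q, hq⟩ ⟨q', hq'⟩ h
    have h : permQ (sig (chiQ q)) q = permQ (sig (chiQ q')) q' := congrArg Subtype.val h
    have h1 := congrArg chiQ h
    rw [hF, hF] at h1
    have h2 := FF_inj _ ((DD1 _).1 hq) _ ((DD1 _).1 hq') h1
    rw [h2] at h
    have h3 := congrArg (permQ (sig (chiQ q'))) h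
    rw [permQ_permQ _ (sig_sig _), permQ_permQ _ (sig_sig _)] at h3
    exact Subtype.ext h3
  · rintro ⟨q, hq⟩
    obtain ⟨c, hc, hcq⟩ := FF_surj _ ((DD2 _).1 hq)
    have h1 : chiQ (permQ (sig c) q) = c := by
      rw [chiQ_permQ _ (sig_sig _), ← hcq]
      funext i
      change c (sig c (sig c i)) = c i
      rw [sig_sig]
    refine ⟨⟨permQ (sig c) q, by rw [h1, DD1]; exact hc⟩, Subtype.ext ?_⟩
    change permQ (sig (chiQ (permQ (sig c) q))) (permQ (sig c) q) = q
    rw [h1, permQ_permQ _ (sig_sig _)]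

/-- The Gassmann phenomenon: there are two non-isomorphic compact semisimple Lie groups,
namely quotients of `SU(2)ⁿ` by central subgroups `Z₁, Z₂`, whose irreducible complex
representations have the same multiset of dimensions (equal Witten zeta-functions): for
every `d`, the two quotients have equally many irreducible continuous `d`-dimensional
representations. -/
theorem gassmann_su2_quotients :
    ∃ (n : ℕ) (Z₁ Z₂ : Subgroup (Fin n → SU2)) (h₁ : Z₁.Normal) (h₂ : Z₂.Normal),
      Z₁ ≤ Subgroup.center (Fin n → SU2) ∧ Z₂ ≤ Subgroup.center (Fin n → SU2) ∧
      (letI := h₁; letI := h₂;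
        (¬ ∃ e : ((Fin n → SU2) ⧸ Z₁) ≃* ((Fin n → SU2) ⧸ Z₂),
            Continuous e ∧ Continuous e.symm) ∧
        ∀ d : ℕ, repDimCard ((Fin n → SU2) ⧸ Z₁) d = repDimCard ((Fin n → SU2) ⧸ Z₂) d) := by
  refine ⟨6, ZZ C1, ZZ C2, ZZ_normal C1, ZZ_normal C2, ZZ_le C1, ZZ_le C2, ?_, cards⟩
  rintro ⟨e, -, -⟩
  exact not_PP1 (PP_equiv e.symm PP2)
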